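/- Let V be a finite-dimensional, first-quadrant bigraded vector space over ℚ of slope C ∈ ℚ, and let M be a finitely detected Sym(V^∨)-module of finite type. Then the graded dimension of any ray of slope C in M is eventually equal to a quasi-polynomial of degree at most dim_ℚ V^0 − 1 and period dividing lcm(V^0). -/

import Mathlib

/-!
Statement 5: Let `V` be a finite dimensional, first-quadrant bigraded vector space over ℚ
of slope `C`, and let `M` be a finitely detected `Sym(V^∨)`-module of finite type.  Then
the graded dimension of any ray of slope `C` in `M` is eventually equal to a
quasi-polynomial of degree at most `dim V⁰ − 1` and period dividing `lcm(V⁰)`.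

Conventions as in the paper: a bigraded vector space is a family `V : ℤ × ℤ → Type` of
ℚ-vector spaces; `Sym(W)` is the free bigraded-commutative algebra on `W`, realized as a
quotient of the tensor algebra on `⊕ W_p`; since the monomials `∂_p` span `Sym(V^∨)`,
detection by the monomial operators `∂_p` is expressed equivalently by detection by all
elements `x : Sym(V^∨)`.
-/

open scoped DirectSum

section GSym

variable (W : ℤ × ℤ → Type) [∀ p, AddCommGroup (W p)] [∀ p, Module ℚ (W p)]

/-- The Koszul sign commutation relation defining the free bigraded-commutative algebra. -/
inductive GSymRel : TensorAlgebra ℚ (⨁ p, W p) → TensorAlgebra ℚ (⨁ p, W p) → Prop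
  | comm (p q : ℤ × ℤ) (x : W p) (y : W q) :
      GSymRel (TensorAlgebra.ι ℚ (DirectSum.of W p x) * TensorAlgebra.ι ℚ (DirectSum.of W q y))
        (((-1 : ℚ) ^ (p.2 * q.2)) •
          (TensorAlgebra.ι ℚ (DirectSum.of W q y) * TensorAlgebra.ι ℚ (DirectSum.of W p x)))

/-- The free bigraded-commutative algebra `Sym(W)` on the bigraded vector space `W`. -/
def GSym := RingQuot (GSymRel W)

noncomputable instance : Ring (GSym W) := inferInstanceAs (Ring (RingQuot (GSymRel W)))
noncomputable instance : Algebra ℚ (GSym W) :=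
  inferInstanceAs (Algebra ℚ (RingQuot (GSymRel W)))

/-- The generator of `Sym(W)` corresponding to `x ∈ W_p`. -/
noncomputable def GSym.gen (p : ℤ × ℤ) (x : W p) : GSym W :=
  RingQuot.mkAlgHom ℚ (GSymRel W) (TensorAlgebra.ι ℚ (DirectSum.of W p x))

/-- The bigraded piece of `Sym(W)` of bidegree `p`. -/
noncomputable def GSym.grade (p : ℤ × ℤ) : Submodule ℚ (GSym W) :=
  Submodule.span ℚ {a : GSym W | ∃ l : List (Σ q : ℤ × ℤ, W q),
    (l.map Sigma.fst).sum = p ∧ a = (l.map fun t => GSym.gen W t.1 t.2).prod}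

/-- `W` is of finite type if each bigraded piece is finite dimensional. -/
def Bigraded.FiniteType : Prop := ∀ p, FiniteDimensional ℚ (W p)

/-- `W` is first-quadrant if it vanishes in negative weights and in negative degrees. -/
def Bigraded.FirstQuadrant : Prop :=
  ∀ p : ℤ × ℤ, (p.1 < 0 ∨ p.2 < 0) → Subsingleton (W p)

/-- The dual bigraded vector space: `(W^∨)_{n,i} = (W_{-n,-i})^∨`. -/
def Bigraded.dual (p : ℤ × ℤ) : Type := Module.Dual ℚ (W (-p.1, -p.2))

noncomputable instance (p : ℤ × ℤ) : AddCommGroup (Bigraded.dual W p) :=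
  inferInstanceAs (AddCommGroup (Module.Dual ℚ (W (-p.1, -p.2))))

noncomputable instance (p : ℤ × ℤ) : Module ℚ (Bigraded.dual W p) :=
  inferInstanceAs (Module ℚ (Module.Dual ℚ (W (-p.1, -p.2))))

end GSym

/-- `W` is of slope `C` if every nonvanishing bigraded piece `W_{n,i}` has `n ≠ 0` and
`i / n = C`. -/
def Bigraded.OfSlope (W : ℤ × ℤ → Type) [∀ p, AddCommGroup (W p)] [∀ p, Module ℚ (W p)]
    (C : ℚ) : Prop :=
  ∀ p : ℤ × ℤ, Nontrivial (W p) → p.1 ≠ 0 ∧ (p.2 : ℚ) / (p.1 : ℚ) = C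

/-- A module `M` over an algebra `A` is finitely detected if there is a surjective
ℚ-linear map `q` from `M` onto a finite dimensional space such that every nonzero
`m ∈ M` satisfies `q (x • m) ≠ 0` for some `x ∈ A`. -/
def FinitelyDetected (A : Type) [Ring A] (M : Type) [AddCommGroup M]
    [Module ℚ M] [Module A M] : Prop :=
  ∃ (N : Type) (_ : AddCommGroup N) (_ : Module ℚ N), FiniteDimensional ℚ N ∧
    ∃ q : M →ₗ[ℚ] N, Function.Surjective q ∧
      ∀ m : M, m ≠ 0 → ∃ x : A, q (x • m) ≠ 0


/-- iterated forward differences with steps in the list are eventually zero -/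
def EvD : List ℤ → (ℤ → ℚ) → Prop
  | [], h => ∃ N : ℤ, ∀ n, N ≤ n → h n = 0
  | w :: l, h => EvD l (fun n => h (n + w) - h n)

lemma EvD.congr : ∀ (l : List ℤ) (_ : ∀ w ∈ l, 0 ≤ w) {f g : ℤ → ℚ} (N : ℤ)
    (_ : ∀ n, N ≤ n → f n = g n), EvD l f → EvD l g
  | [], _, f, g, N, h, ⟨N', h'⟩ => ⟨max N N', fun n hn => by
      rw [← h n (le_trans (le_max_left _ _) hn), h' n (le_trans (le_max_right _ _) hn)]⟩
  | w :: l, hw, f, g, N, h, hf => by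
      refine EvD.congr l (fun v hv => hw v (List.mem_cons_of_mem _ hv)) N (fun n hn => ?_)
        (show EvD l _ from hf)
      have : 0 ≤ w := hw w List.mem_cons_self
      show f (n + w) - f n = g (n + w) - g n
      rw [h n hn, h (n + w) (by omega)]

lemma EvD.sub : ∀ (l : List ℤ) {f g : ℤ → ℚ}, EvD l f → EvD l g → EvD l (fun n => f n - g n)
  | [], f, g, ⟨N, h⟩, ⟨N', h'⟩ => ⟨max N N', fun n hn => by
      simp only []
      rw [h n (le_trans (le_max_left _ _) hn), h' n (le_trans (le_max_right _ _) hn), sub_zero]⟩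
  | w :: l, f, g, hf, hg => by
      have := EvD.sub l hf hg
      show EvD l _
      convert this using 2
      ring

lemma EvD.add : ∀ (l : List ℤ) {f g : ℤ → ℚ}, EvD l f → EvD l g → EvD l (fun n => f n + g n)
  | [], f, g, ⟨N, h⟩, ⟨N', h'⟩ => ⟨max N N', fun n hn => by
      simp only []
      rw [h n (le_trans (le_max_left _ _) hn), h' n (le_trans (le_max_right _ _) hn), add_zero]⟩
  | w :: l, f, g, hf, hg => by
      have := EvD.add l hf hg
      show EvD l _
      convert this using 2
      ring

lemma EvD.zero : ∀ (l : List ℤ), EvD l (fun _ => 0)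
  | [] => ⟨0, fun _ _ => rfl⟩
  | w :: l => by
      show EvD l _
      simpa using EvD.zero l

lemma EvD.shift : ∀ (l : List ℤ) {f : ℤ → ℚ} (k : ℤ), EvD l f → EvD l (fun n => f (n + k))
  | [], f, k, ⟨N, h⟩ => ⟨N - k, fun n hn => h _ (by omega)⟩
  | w :: l, f, k, hf => by
      have := EvD.shift l k hf
      show EvD l _
      convert this using 4
      ring

lemma EvD.replicate (T : ℤ) : ∀ (l : List ℤ) (_ : ∀ w ∈ l, ∃ c : ℕ, T = c * w) {f : ℤ → ℚ},
    EvD l f → EvD (List.replicate l.length T) f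
  | [], _, f, hf => hf
  | w :: l, hw, f, hf => by
      have ih := EvD.replicate T l (fun v hv => hw v (List.mem_cons_of_mem _ hv))
        (show EvD l _ from hf)
      obtain ⟨c, rfl⟩ := hw w List.mem_cons_self
      rw [List.length_cons, List.replicate_succ]
      change EvD _ (fun n => f (n + c * w) - f n)
      generalize List.replicate l.length (c * w) = l' at ih ⊢
      clear hf hw
      induction c with
      | zero => simpa using EvD.zero l'
      | succ c ihc =>
        have := EvD.add l' (EvD.shift l' (c * w) ih) ihc
        convert this using 2 with n
        push_cast
        ring_nf

lemma EvD.iterate (T : ℤ) : ∀ (d : ℕ) {f : ℤ → ℚ}, EvD (List.replicate d T) f →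
    ∃ N : ℤ, ∀ n, N ≤ n → (fwdDiff T)^[d] f n = 0
  | 0, _, h => h
  | d + 1, f, h => EvD.iterate T d (f := fwdDiff T f) h

lemma EvD.poly (T : ℤ) (hT : 0 < T) (d : ℕ) {f : ℤ → ℚ} (h : EvD (List.replicate d T) f) (j : ℤ) :
    ∃ P : Polynomial ℚ, P.degree < d ∧ ∃ N : ℤ, ∀ n, N ≤ n → T ∣ n - j →
      f n = P.eval (n : ℚ) := by
  obtain ⟨N, hN⟩ := EvD.iterate T d h
  have hz : ∀ k, d ≤ k → ∀ n, N ≤ n → (fwdDiff T)^[k] f n = 0 := by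
    intro k hk
    induction k, hk using Nat.le_induction with
    | base => exact hN
    | succ k hk ih =>
      intro n hn
      rw [Function.iterate_succ_apply', fwdDiff, ih n hn, ih _ (by omega), sub_zero]
  -- base point
  obtain ⟨y, hy, hyj⟩ : ∃ y, N ≤ y ∧ T ∣ y - j := by
    refine ⟨j + T * |N - j|, ?_, by simp⟩
    have := le_abs_self (N - j)
    nlinarith [abs_nonneg (N - j)]
  let Q : Polynomial ℚ := ∑ k ∈ Finset.range d,
    Polynomial.C ((fwdDiff T)^[k] f y / (k.factorial : ℚ)) * descPochhammer ℚ k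
  let L : Polynomial ℚ := Polynomial.C (1 / (T : ℚ)) * (Polynomial.X - Polynomial.C (y : ℚ))
  have hTq : (T : ℚ) ≠ 0 := by exact_mod_cast hT.ne'
  have hQ : Q.degree < d := by
    refine (Polynomial.degree_sum_le _ _).trans_lt ?_
    refine (Finset.sup_lt_iff (WithBot.bot_lt_coe d)).2 fun k hk => ?_
    rw [← Polynomial.smul_eq_C_mul]
    refine (Polynomial.degree_smul_le _ _).trans_lt ?_
    refine Polynomial.degree_le_natDegree.trans_lt ?_
    rw [descPochhammer_natDegree]
    exact WithBot.coe_lt_coe.2 (Finset.mem_range.1 hk)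
  have hL : L.natDegree = 1 := by
    simp only [L]
    rw [Polynomial.natDegree_C_mul (by positivity), Polynomial.natDegree_X_sub_C]
  refine ⟨Q.comp L, ?_, y, fun n hn hnj => ?_⟩
  · by_cases h0 : Q.comp L = 0
    · rw [h0, Polynomial.degree_zero]; exact WithBot.bot_lt_coe d
    · have hQ0 : Q ≠ 0 := by rintro h; simp [h] at h0
      rw [Polynomial.degree_eq_natDegree h0, Polynomial.natDegree_comp, hL, mul_one,
        ← Polynomial.degree_eq_natDegree hQ0]
      exact hQ
  · obtain ⟨c, hc⟩ : T ∣ n - y := by simpa using dvd_sub hnj hyj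
    have hc0 : 0 ≤ c := by
      by_contra hneg
      nlinarith
    lift c to ℕ using hc0
    have hn' : n = y + c • T := by rw [nsmul_eq_mul]; linarith
    have hev : L.eval (n : ℚ) = c := by
      rw [hn']; simp [L]; field_simp
    rw [Polynomial.eval_comp, hev]
    rw [hn', shift_eq_sum_fwdDiff_iter T f c y]
    simp only [Q, Polynomial.eval_finsetSum, Polynomial.eval_mul, Polynomial.eval_C,
      descPochhammer_eval_eq_descFactorial]
    have e : ∀ k, (fwdDiff T)^[k] f y / (k.factorial : ℚ) * (c.descFactorial k : ℚ)
        = c.choose k • (fwdDiff T)^[k] f y := by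
      intro k
      rw [Nat.descFactorial_eq_factorial_mul_choose, nsmul_eq_mul]
      have : (k.factorial : ℚ) ≠ 0 := by exact_mod_cast k.factorial_ne_zero
      push_cast
      field_simp
    simp only [e]
    -- compare the two sums through range (max ..)
    have e1 : ∑ k ∈ Finset.range (c + 1), c.choose k • (fwdDiff T)^[k] f y
        = ∑ k ∈ Finset.range (max (c + 1) d), c.choose k • (fwdDiff T)^[k] f y := by
      refine Finset.sum_subset (Finset.range_mono (le_max_left _ _)) fun k _ hk => ?_
      rw [Finset.mem_range, not_lt] at hk
      rw [Nat.choose_eq_zero_of_lt (by omega), zero_smul]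
    have e2 : ∑ k ∈ Finset.range d, c.choose k • (fwdDiff T)^[k] f y
        = ∑ k ∈ Finset.range (max (c + 1) d), c.choose k • (fwdDiff T)^[k] f y := by
      refine Finset.sum_subset (Finset.range_mono (le_max_right _ _)) fun k _ hk => ?_
      rw [Finset.mem_range, not_lt] at hk
      rw [hz k hk y hy, smul_zero]
    rw [e1, e2]

lemma finite_ortho {Z : Type} [AddCommGroup Z] [Module ℚ Z] [FiniteDimensional ℚ Z]
    (π : ℤ → Z →ₗ[ℚ] Z) (hid : ∀ u m, π u (π u m) = π u m)
    (hort : ∀ u v m, u ≠ v → π u (π v m) = 0) :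
    ∃ N : ℤ, ∀ u, N ≤ u → ∀ m, π u m = 0 := by
  classical
  let U := {u : ℤ // ∃ m, π u m ≠ 0}
  choose m hm using fun u : U => u.2
  have li : LinearIndependent ℚ (fun u : U => π u (m u)) := by
    rw [linearIndependent_iff']
    intro s g hg i hi
    have := congrArg (π i) hg
    rw [map_zero, map_sum, Finset.sum_eq_single i] at this
    · rw [map_smul, hid] at this
      exact (smul_eq_zero.1 this).resolve_right (hm i)
    · intro b _ hb
      rw [map_smul, hort _ _ _ (fun h => hb (Subtype.ext h.symm)), smul_zero]
    · exact fun h => absurd hi h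
  have hfin : Finite U := li.finite
  have hf : Set.Finite {u : ℤ | ∃ m, π u m ≠ 0} := hfin
  obtain ⟨B, hB⟩ := hf.bddAbove
  refine ⟨B + 1, fun u hu m => ?_⟩
  by_contra hne
  have := hB (show u ∈ {u : ℤ | ∃ m, π u m ≠ 0} from ⟨m, hne⟩)
  omega

lemma finrank_congr_eq {M : Type} [AddCommGroup M] [Module ℚ M] {P Q : Submodule ℚ M} (h : P = Q) :
    Module.finrank ℚ P = Module.finrank ℚ Q := by rw [h]

theorem hilbert_serre {R : Type} [CommRing R] [Algebra ℚ R] [IsNoetherianRing R] {σ : Type}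
    (x : σ → R) (hx : Algebra.adjoin ℚ (Set.range x) = ⊤) (w : σ → ℤ) :
    ∀ (l : List σ) (M : Type) [AddCommGroup M] [Module ℚ M] [Module R M] [IsScalarTower ℚ R M]
      [Module.Finite R M] (π : ℤ → M →ₗ[ℚ] M) (_ : ∀ u m, π u (π u m) = π u m)
      (_ : ∀ u v m, u ≠ v → π u (π v m) = 0)
      (_ : ∀ i u m, π (u + w i) (x i • m) = x i • π u m)
      (_ : ∀ u, FiniteDimensional ℚ (LinearMap.range (π u)))
      (_ : ∀ i, i ∉ l → ∀ m : M, x i • m = 0),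
      EvD (l.map w) (fun u => (Module.finrank ℚ (LinearMap.range (π u)) : ℚ)) := by
  intro l
  induction l with
  | nil =>
    intro M _ _ _ _ _ π hid hort hcomm hfin hkill
    have hact : ∀ r : R, ∀ m : M, ∃ c : ℚ, r • m = c • m := by
      intro r
      have hr : r ∈ Algebra.adjoin ℚ (Set.range x) := by rw [hx]; trivial
      suffices h : ∃ c : ℚ, ∀ m : M, r • m = c • m from fun m => h.imp fun c hc => hc m
      induction hr using Algebra.adjoin_induction with
      | mem y hy =>
        obtain ⟨i, rfl⟩ := hy
        exact ⟨0, fun m => by rw [hkill i (by simp) m, zero_smul]⟩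
      | algebraMap c => exact ⟨c, fun m => algebraMap_smul R c m⟩
      | add y z _ _ h1 h2 =>
        obtain ⟨c, hc⟩ := h1
        obtain ⟨d, hd⟩ := h2
        exact ⟨c + d, fun m => by rw [add_smul, add_smul, hc, hd]⟩
      | mul y z _ _ h1 h2 =>
        obtain ⟨c, hc⟩ := h1
        obtain ⟨d, hd⟩ := h2
        exact ⟨c * d, fun m => by rw [mul_smul, mul_smul, hd, hc]⟩
    have hMf : FiniteDimensional ℚ M := by
      obtain ⟨s, hs⟩ := Module.Finite.fg_top (R := R) (M := M)
      refine ⟨⟨s, ?_⟩⟩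
      rw [eq_top_iff]
      intro m _
      have hm : m ∈ Submodule.span R (s : Set M) := by rw [hs]; trivial
      induction hm using Submodule.span_induction with
      | mem y hy => exact Submodule.subset_span hy
      | zero => exact Submodule.zero_mem _
      | add y z _ _ h1 h2 => exact Submodule.add_mem _ (h1 trivial) (h2 trivial)
      | smul r y _ h =>
        obtain ⟨c, hc⟩ := hact r y
        rw [hc]
        exact Submodule.smul_mem _ _ (h trivial)
    obtain ⟨N, hN⟩ := finite_ortho π hid hort
    refine ⟨N, fun u hu => ?_⟩
    have : π u = 0 := LinearMap.ext (hN u hu)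
    simp [this]
  | cons i l ih =>
    intro M _ _ _ _ _ π hid hort hcomm hfin hkill
    have : IsNoetherian R M := isNoetherian_of_isNoetherianRing_of_finite R M
    let K : Submodule R M := LinearMap.ker (LinearMap.lsmul R M (x i))
    let I : Submodule R M := LinearMap.range (LinearMap.lsmul R M (x i))
    have memK : ∀ m, m ∈ K ↔ x i • m = 0 := fun m => LinearMap.mem_ker
    have memI : ∀ m, m ∈ I ↔ ∃ y, x i • y = m := fun m => LinearMap.mem_range
    have hKst : ∀ u, ∀ m ∈ K, π u m ∈ K := by
      intro u m hm
      rw [memK] at hm ⊢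
      rw [← hcomm, hm, map_zero]
    have hIst : ∀ u, ∀ m ∈ I, π u m ∈ I := by
      intro u m hm
      rw [memI] at hm ⊢
      obtain ⟨y, rfl⟩ := hm
      exact ⟨π (u - w i) y, by rw [← hcomm]; simp⟩
    let πK : ℤ → K →ₗ[ℚ] K := fun u =>
      LinearMap.restrict (p := K.restrictScalars ℚ) (q := K.restrictScalars ℚ) (π u) (hKst u)
    have πK_apply : ∀ u (k : K), ((πK u k : K) : M) = π u k := fun u k => rfl
    let e := Submodule.Quotient.restrictScalarsEquiv ℚ I
    let πQ : ℤ → (M ⧸ I) →ₗ[ℚ] (M ⧸ I) := fun u =>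
      e.toLinearMap ∘ₗ (Submodule.mapQ (I.restrictScalars ℚ) (I.restrictScalars ℚ) (π u) (hIst u))
        ∘ₗ e.symm.toLinearMap
    have πQ_apply : ∀ u (m : M), πQ u (Submodule.Quotient.mk m) = Submodule.Quotient.mk (π u m) :=
      fun u m => rfl
    -- dimensions
    let sub : K →ₗ[ℚ] M := K.subtype.restrictScalars ℚ
    have sub_inj : Function.Injective sub := Subtype.val_injective
    have rK : ∀ u, ∀ m, m ∈ (LinearMap.range (πK u)).map sub ↔
        m ∈ LinearMap.range (π u) ∧ x i • m = 0 := by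
      intro u m
      constructor
      · rintro ⟨k, ⟨k', rfl⟩, rfl⟩
        exact ⟨⟨k', rfl⟩, (memK _).1 (πK u k').2⟩
      · rintro ⟨⟨y, rfl⟩, h⟩
        refine ⟨⟨π u y, (memK _).2 h⟩, ⟨⟨π u y, (memK _).2 h⟩, ?_⟩, rfl⟩
        exact Subtype.ext (hid u y)
    let mk : M →ₗ[ℚ] M ⧸ I := I.mkQ.restrictScalars ℚ
    have rQ : ∀ u, LinearMap.range (πQ u) = (LinearMap.range (π u)).map mk := by
      intro u
      ext z
      constructor
      · rintro ⟨y, rfl⟩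
        obtain ⟨y, rfl⟩ := Submodule.Quotient.mk_surjective I y
        exact ⟨π u y, ⟨y, rfl⟩, rfl⟩
      · rintro ⟨_, ⟨y, rfl⟩, rfl⟩
        exact ⟨Submodule.Quotient.mk y, rfl⟩
    have hKf : ∀ u, FiniteDimensional ℚ (LinearMap.range (πK u)) := by
      intro u
      have : FiniteDimensional ℚ
          ((LinearMap.range (πK u)).map sub) :=
        Submodule.finiteDimensional_of_le (S₂ := LinearMap.range (π u))
          (fun m hm => ((rK u m).1 hm).1)
      exact Module.Finite.equiv (Submodule.equivMapOfInjective sub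
        sub_inj (LinearMap.range (πK u))).symm
    have hQf : ∀ u, FiniteDimensional ℚ (LinearMap.range (πQ u)) := by
      intro u
      rw [rQ]
      infer_instance
    have ihK := ih K πK (fun u m => Subtype.ext (hid u m))
      (fun u v m h => Subtype.ext (hort u v m h))
      (fun j u m => Subtype.ext (hcomm j u m)) hKf (by
        intro j hj m
        by_cases hji : j = i
        · subst hji; exact Subtype.ext ((memK _).1 m.2)
        · exact Subtype.ext (hkill j (by simp [hji, hj]) m))
    have ihQ := ih (M ⧸ I) πQ
      (by
        intro u m
        obtain ⟨m, rfl⟩ := Submodule.Quotient.mk_surjective I m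
        rw [πQ_apply, πQ_apply, hid])
      (by
        intro u v m h
        obtain ⟨m, rfl⟩ := Submodule.Quotient.mk_surjective I m
        rw [πQ_apply, πQ_apply, hort u v m h]; rfl)
      (by
        intro j u m
        obtain ⟨m, rfl⟩ := Submodule.Quotient.mk_surjective I m
        rw [πQ_apply, ← Submodule.Quotient.mk_smul, ← Submodule.Quotient.mk_smul, πQ_apply, hcomm])
      hQf (by
        intro j hj m
        obtain ⟨m, rfl⟩ := Submodule.Quotient.mk_surjective I m
        rw [← Submodule.Quotient.mk_smul]
        by_cases hji : j = i
        · subst hji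
          exact (Submodule.Quotient.mk_eq_zero I).2 ((memI _).2 ⟨m, rfl⟩)
        · rw [hkill j (by simp [hji, hj]) m]; rfl)
    have key : ∀ u, (Module.finrank ℚ (LinearMap.range (π (u + w i))) : ℚ)
        - Module.finrank ℚ (LinearMap.range (π u))
        = Module.finrank ℚ (LinearMap.range (πQ (u + w i)))
        - Module.finrank ℚ (LinearMap.range (πK u)) := by
      intro u
      let xs : M →ₗ[ℚ] M := (LinearMap.lsmul R M (x i)).restrictScalars ℚ
      have xs_apply : ∀ m, xs m = x i • m := fun m => rfl
      have h1 := LinearMap.finrank_range_add_finrank_ker (xs.domRestrict (LinearMap.range (π u)))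
      have h2 := LinearMap.finrank_range_add_finrank_ker
        (mk.domRestrict (LinearMap.range (π (u + w i))))
      have e1 : Module.finrank ℚ (LinearMap.ker (xs.domRestrict (LinearMap.range (π u))))
          = Module.finrank ℚ (LinearMap.range (πK u)) := by
        rw [← Submodule.finrank_map_subtype_eq,
          (Submodule.equivMapOfInjective sub sub_inj (LinearMap.range (πK u))).finrank_eq]
        refine finrank_congr_eq ?_
        ext m
        rw [rK]
        constructor
        · rintro ⟨k, hk, rfl⟩
          exact ⟨k.2, hk⟩
        · rintro ⟨h, h'⟩
          exact ⟨⟨m, h⟩, h', rfl⟩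
      have e2 : Module.finrank ℚ (LinearMap.range
            (mk.domRestrict (LinearMap.range (π (u + w i)))))
          = Module.finrank ℚ (LinearMap.range (πQ (u + w i))) := by
        rw [rQ, LinearMap.range_domRestrict]
      have e3 : Module.finrank ℚ (LinearMap.ker
            (mk.domRestrict (LinearMap.range (π (u + w i)))))
          = Module.finrank ℚ (LinearMap.range (xs.domRestrict (LinearMap.range (π u)))) := by
        rw [← Submodule.finrank_map_subtype_eq]
        refine finrank_congr_eq ?_
        ext m
        constructor
        · rintro ⟨⟨k, ⟨y, hy⟩⟩, hk, rfl⟩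
          have hk' : k ∈ I := (Submodule.Quotient.mk_eq_zero I).1 hk
          obtain ⟨z, hz⟩ := (memI _).1 hk'
          refine ⟨⟨π u z, ⟨z, rfl⟩⟩, ?_⟩
          show x i • π u z = k
          rw [← hcomm, hz, ← hy, hid]
        · rintro ⟨⟨_, ⟨y, rfl⟩⟩, rfl⟩
          refine ⟨⟨x i • π u y, ⟨x i • y, hcomm _ _ _⟩⟩, ?_, rfl⟩
          exact (Submodule.Quotient.mk_eq_zero I).2 ((memI _).2 ⟨_, rfl⟩)
      rw [e1] at h1
      rw [e2, e3] at h2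
      rw [← h1, ← h2]
      push_cast
      ring
    show EvD (l.map w) _
    simp only [key]
    exact EvD.sub _ (EvD.shift _ (w i) ihQ) ihK

/-- The transposed action of a commutative algebra on the full dual. -/
@[reducible] def dualMod (R : Type) [CommRing R] [Algebra ℚ R] (M : Type) [AddCommGroup M]
    [Module ℚ M] [Module R M] [IsScalarTower ℚ R M] : Module R (Module.Dual ℚ M) where
  smul r φ := φ ∘ₗ (LinearMap.lsmul R M r).restrictScalars ℚ
  one_smul φ := LinearMap.ext fun m => congrArg φ (one_smul R m)
  mul_smul r s φ := LinearMap.ext fun m => congrArg φ (by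
    show (r * s) • m = s • r • m
    rw [mul_comm, mul_smul])
  smul_zero r := rfl
  smul_add r φ ψ := rfl
  add_smul r s φ := LinearMap.ext fun m => by
    show φ ((r + s) • m) = φ (r • m) + φ (s • m)
    rw [add_smul, map_add]
  zero_smul φ := LinearMap.ext fun m => by
    show φ ((0 : R) • m) = 0
    rw [zero_smul, map_zero]

theorem dual_growth {R : Type} [CommRing R] [Algebra ℚ R] [IsNoetherianRing R] {σ : Type}
    [Fintype σ] (x : σ → R) (hx : Algebra.adjoin ℚ (Set.range x) = ⊤) (w : σ → ℤ)
    (hw : ∀ i, 0 < w i)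
    (M : Type) [AddCommGroup M] [Module ℚ M] [Module R M] [IsScalarTower ℚ R M]
    (π : ℤ → M →ₗ[ℚ] M) (hid : ∀ u m, π u (π u m) = π u m)
    (hort : ∀ u v m, u ≠ v → π u (π v m) = 0)
    (hcomm : ∀ i u m, π u (x i • m) = x i • π (u + w i) m)
    (hfin : ∀ u, FiniteDimensional ℚ (LinearMap.range (π u)))
    (n0 : ℤ) (hsoc : ∀ u, n0 ≤ u → ∀ m, (∀ i, x i • π u m = 0) → π u m = 0) :
    EvD ((Finset.univ : Finset σ).toList.map w)
      (fun u => (Module.finrank ℚ (LinearMap.range (π u)) : ℚ)) := by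
  classical
  let _ := dualMod R M
  have smul_apply : ∀ (r : R) (φ : Module.Dual ℚ M) (m : M), (r • φ) m = φ (r • m) :=
    fun _ _ _ => rfl
  have _ : IsScalarTower ℚ R (Module.Dual ℚ M) := ⟨fun c r φ => LinearMap.ext fun m => by
    rw [smul_apply, LinearMap.smul_apply, smul_apply, smul_assoc, map_smul]⟩
  let τ : ℤ → Module.Dual ℚ M →ₗ[ℚ] Module.Dual ℚ M := fun u => (π u).dualMap
  have τ_apply : ∀ u φ m, τ u φ m = φ (π u m) := fun _ _ _ => rfl
  have τid : ∀ u φ, τ u (τ u φ) = τ u φ := fun u φ => LinearMap.ext fun m => by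
    simp only [τ_apply, hid]
  have τort : ∀ u v φ, u ≠ v → τ u (τ v φ) = 0 := fun u v φ h => LinearMap.ext fun m => by
    simp only [τ_apply, hort v u m h.symm, map_zero, LinearMap.zero_apply]
  have τcomm : ∀ i u φ, τ (u + w i) (x i • φ) = x i • τ u φ := fun i u φ =>
    LinearMap.ext fun m => by
      simp only [τ_apply, smul_apply, hcomm]
  have τrank : ∀ u, Module.finrank ℚ (LinearMap.range (τ u))
      = Module.finrank ℚ (LinearMap.range (π u)) :=
    fun u => LinearMap.finrank_range_dualMap_eq_finrank_range _
  have τfin : ∀ u, FiniteDimensional ℚ (LinearMap.range (τ u)) := by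
    intro u
    -- `τ u` factors through the dual of `range (π u)`
    have : LinearMap.range (τ u) ≤ LinearMap.range ((π u).rangeRestrict.dualMap) := by
      rintro _ ⟨φ, rfl⟩
      exact ⟨φ ∘ₗ (LinearMap.range (π u)).subtype, rfl⟩
    exact Submodule.finiteDimensional_of_le this
  let W : ℤ := ∑ i, w i
  have hW : ∀ i, w i ≤ W := fun i =>
    Finset.single_le_sum (f := w) (fun j _ => (hw j).le) (Finset.mem_univ i)
  let G : Set (Module.Dual ℚ M) := ⋃ v ∈ Finset.Ico (n0 - W) n0, (LinearMap.range (τ v) : Set _)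
  let D : Submodule R (Module.Dual ℚ M) := Submodule.span R G
  have hDfg : D.FG := by
    have hfg : (⨆ v ∈ Finset.Ico (n0 - W) n0, LinearMap.range (τ v)).FG :=
      Submodule.fg_biSup _ _ fun v _ => (Submodule.fg_iff_finiteDimensional _).2 (τfin v)
    obtain ⟨s, hs⟩ := hfg
    refine ⟨s, le_antisymm (Submodule.span_le.2 ?_) (Submodule.span_le.2 ?_)⟩
    · intro φ hφ
      have h1 : φ ∈ (⨆ v ∈ Finset.Ico (n0 - W) n0, LinearMap.range (τ v)) := by
        rw [← hs]; exact Submodule.subset_span hφ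
      have h2 : (⨆ v ∈ Finset.Ico (n0 - W) n0, LinearMap.range (τ v)) ≤ D.restrictScalars ℚ := by
        refine iSup₂_le fun v hv ψ hψ => ?_
        exact Submodule.subset_span (Set.mem_iUnion₂.2 ⟨v, hv, hψ⟩)
      exact h2 h1
    · intro φ hφ
      obtain ⟨v, hv, hψ⟩ := Set.mem_iUnion₂.1 hφ
      have h1 : φ ∈ Submodule.span ℚ (s : Set (Module.Dual ℚ M)) := by
        rw [hs]
        exact (le_iSup₂ (f := fun v (_ : v ∈ Finset.Ico (n0 - W) n0) => LinearMap.range (τ v)) v hv)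
          hψ
      exact Submodule.span_le_restrictScalars ℚ R _ h1
  have hDst : ∀ φ ∈ D, ∀ u, τ u φ ∈ D := by
    intro φ hφ
    induction hφ using Submodule.span_induction with
    | mem φ hφ =>
      intro u
      obtain ⟨v, hv, ψ, rfl⟩ := Set.mem_iUnion₂.1 hφ
      by_cases h : u = v
      · subst h
        rw [τid]
        exact Submodule.subset_span hφ
      · rw [τort u v ψ h]
        exact D.zero_mem
    | zero => intro u; rw [map_zero]; exact D.zero_mem
    | add φ ψ _ _ h1 h2 => intro u; rw [map_add]; exact D.add_mem (h1 u) (h2 u)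
    | smul r φ _ h =>
      have hr : r ∈ Algebra.adjoin ℚ (Set.range x) := by rw [hx]; trivial
      clear * - hr h τcomm
      induction hr using Algebra.adjoin_induction generalizing φ with
      | mem y hy =>
        obtain ⟨i, rfl⟩ := hy
        intro u
        have := τcomm i (u - w i) φ
        rw [sub_add_cancel] at this
        rw [this]
        exact D.smul_mem _ (h _)
      | algebraMap c =>
        intro u
        rw [algebraMap_smul, map_smul]
        exact (D.restrictScalars ℚ).smul_mem c (h u)
      | add y z _ _ h1 h2 =>
        intro u
        rw [add_smul, map_add]
        exact D.add_mem (h1 φ h u) (h2 φ h u)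
      | mul y z _ _ h1 h2 =>
        intro u
        rw [mul_smul]
        exact h1 _ (fun u => h2 φ h u) u
  have hDall : ∀ k : ℕ, ∀ u, n0 - W ≤ u → u < n0 + k → ∀ φ, τ u φ ∈ D := by
    intro k
    induction k with
    | zero =>
      intro u h1 h2 φ
      exact Submodule.subset_span (Set.mem_iUnion₂.2
        ⟨u, Finset.mem_Ico.2 ⟨h1, by simpa using h2⟩, φ, rfl⟩)
    | succ k ih =>
      intro u h1 h2 φ
      by_cases hlt : u < n0 + k
      · exact ih u h1 hlt φ
      have hu : n0 ≤ u := by omega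
      let J : LinearMap.range (π u) →ₗ[ℚ] (σ → M) := LinearMap.pi fun i =>
        ((LinearMap.lsmul R M (x i)).restrictScalars ℚ) ∘ₗ (LinearMap.range (π u)).subtype
      have hJ : LinearMap.ker J = ⊥ := by
        rw [LinearMap.ker_eq_bot']
        rintro ⟨_, m, rfl⟩ h
        refine Subtype.ext (hsoc u hu m fun i => ?_)
        exact congrFun h i
      obtain ⟨g, hg⟩ := LinearMap.exists_leftInverse_of_injective J hJ
      let ψ : (σ → M) →ₗ[ℚ] ℚ := φ ∘ₗ (LinearMap.range (π u)).subtype ∘ₗ g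
      let ψi : σ → Module.Dual ℚ M := fun i => ψ ∘ₗ LinearMap.single ℚ (fun _ => M) i
      have hsum : τ u φ = ∑ i, x i • τ (u - w i) (ψi i) := by
        ext m
        have hgm : g (J ⟨π u m, m, rfl⟩) = ⟨π u m, m, rfl⟩ := LinearMap.congr_fun hg _
        have e1 : ψ (J ⟨π u m, m, rfl⟩) = φ (π u m) := by
          show φ ((g (J ⟨π u m, m, rfl⟩) : LinearMap.range (π u)) : M) = _
          rw [hgm]
        rw [τ_apply, ← e1, LinearMap.sum_apply]
        have e2 : J ⟨π u m, m, rfl⟩ = ∑ i, Pi.single i (x i • π u m) := by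
          rw [Finset.univ_sum_single]
          rfl
        rw [e2, map_sum]
        refine Finset.sum_congr rfl fun i _ => ?_
        rw [smul_apply, τ_apply, hcomm, sub_add_cancel]
        rfl
      rw [hsum]
      refine D.sum_mem fun i _ => D.smul_mem _ (ih _ ?_ ?_ _)
      · have := hW i; omega
      · have := hw i; omega
  let πD : ℤ → D →ₗ[ℚ] D := fun u =>
    LinearMap.restrict (p := D.restrictScalars ℚ) (q := D.restrictScalars ℚ) (τ u)
      (fun φ hφ => hDst φ hφ u)
  let sub : D →ₗ[ℚ] Module.Dual ℚ M := D.subtype.restrictScalars ℚ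
  have sub_inj : Function.Injective sub := Subtype.val_injective
  have hle : ∀ u, (LinearMap.range (πD u)).map sub ≤ LinearMap.range (τ u) := by
    rintro u _ ⟨_, ⟨d, rfl⟩, rfl⟩
    exact ⟨d, rfl⟩
  have _ : Module.Finite R D := Module.Finite.iff_fg.2 hDfg
  have hs := hilbert_serre x hx w (Finset.univ : Finset σ).toList D πD
    (fun u m => Subtype.ext (τid u m)) (fun u v m h => Subtype.ext (τort u v m h))
    (fun i u m => Subtype.ext (τcomm i u m))
    (fun u => by
      have : FiniteDimensional ℚ ((LinearMap.range (πD u)).map sub) :=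
        Submodule.finiteDimensional_of_le (hle u)
      exact Module.Finite.equiv
        (Submodule.equivMapOfInjective sub sub_inj (LinearMap.range (πD u))).symm)
    (fun i hi => absurd (Finset.mem_toList.2 (Finset.mem_univ i)) hi)
  refine EvD.congr _ ?_ n0 (fun u hu => ?_) hs
  · intro v hv
    obtain ⟨i, _, rfl⟩ := List.mem_map.1 hv
    exact (hw i).le
  · rw [← τrank, (Submodule.equivMapOfInjective sub sub_inj (LinearMap.range (πD u))).finrank_eq]
    congr 1
    refine finrank_congr_eq (le_antisymm (hle u) ?_)
    rintro _ ⟨φ, rfl⟩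
    have hmem : τ u φ ∈ D := by
      have hW0 : 0 ≤ W := Finset.sum_nonneg fun i _ => (hw i).le
      exact hDall (u - n0 + 1).toNat u (by omega) (by omega) φ
    exact ⟨⟨τ u φ, hmem⟩, ⟨⟨τ u φ, hmem⟩, Subtype.ext (τid u φ)⟩, rfl⟩

lemma word_dup_zero {A τ : Type} [Ring A] [Algebra ℚ A] (y : τ → A)
    (hy : ∀ i j, y i * y j = - (y j * y i)) (l : List τ) (hl : ¬ l.Nodup) :
    (l.map y).prod = 0 := by
  have hsq : ∀ i, y i * y i = 0 := fun i => by
    have h := hy i i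
    have h2 : (2 : ℚ) • (y i * y i) = 0 := by
      rw [two_smul]; nth_rewrite 1 [h]; simp
    exact (smul_eq_zero.1 h2).resolve_left (by norm_num)
  -- left multiplication by a letter that occurs kills the word
  have hmem : ∀ (l : List τ) (i : τ), i ∈ l → y i * (l.map y).prod = 0 := by
    intro l i
    induction l with
    | nil => simp
    | cons j l ih =>
      intro h
      rw [List.map_cons, List.prod_cons, ← mul_assoc]
      rcases List.mem_cons.1 h with rfl | h
      · rw [hsq, zero_mul]
      · rw [hy, neg_mul, mul_assoc, ih h, mul_zero, neg_zero]
  induction l with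
  | nil => simp at hl
  | cons j l ih =>
    rw [List.map_cons, List.prod_cons]
    by_cases hj : j ∈ l
    · exact hmem l j hj
    · rw [ih (fun h => hl (List.nodup_cons.2 ⟨hj, h⟩)), mul_zero]

theorem detected_growth {A : Type} [Ring A] [Algebra ℚ A] {σ τ : Type} [Fintype σ] [Fintype τ]
    (z : σ → A) (y : τ → A) (hz : ∀ i a, z i * a = a * z i)
    (hy : ∀ i j, y i * y j = - (y j * y i))
    (hgen : Algebra.adjoin ℚ (Set.range z ∪ Set.range y) = ⊤)
    (w : σ → ℤ) (hw : ∀ i, 0 < w i)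
    (M : Type) [AddCommGroup M] [Module ℚ M] [Module A M] [IsScalarTower ℚ A M]
    (hdet : ∃ (N : Type) (_ : AddCommGroup N) (_ : Module ℚ N), FiniteDimensional ℚ N ∧
      ∃ q : M →ₗ[ℚ] N, ∀ m : M, m ≠ 0 → ∃ x : A, q (x • m) ≠ 0)
    (π : ℤ → M →ₗ[ℚ] M) (hid : ∀ u m, π u (π u m) = π u m)
    (hort : ∀ u v m, u ≠ v → π u (π v m) = 0)
    (hcomm : ∀ i u m, π u (z i • m) = z i • π (u + w i) m)
    (hfin : ∀ u, FiniteDimensional ℚ (LinearMap.range (π u))) :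
    EvD ((Finset.univ : Finset σ).toList.map w)
      (fun u => (Module.finrank ℚ (LinearMap.range (π u)) : ℚ)) := by
  classical
  obtain ⟨N, _, _, hNf, q, hq⟩ := hdet
  let f0 : MvPolynomial σ ℚ →ₐ[ℚ] Subalgebra.center ℚ A := MvPolynomial.aeval fun i =>
    ⟨z i, Subalgebra.mem_center_iff.2 fun a => (hz i a).symm⟩
  let f : MvPolynomial σ ℚ →ₐ[ℚ] A := (Subalgebra.center ℚ A).val.comp f0
  have fc : ∀ r a, f r * a = a * f r := fun r a => (Subalgebra.mem_center_iff.1 (f0 r).2 a).symm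
  have fX : ∀ i, f (MvPolynomial.X i) = z i := fun i => by simp [f, f0]
  let _ : Module (MvPolynomial σ ℚ) M := Module.compHom M f.toRingHom
  have smul_def : ∀ (r : MvPolynomial σ ℚ) (m : M), r • m = f r • m := fun _ _ => rfl
  have _ : IsScalarTower ℚ (MvPolynomial σ ℚ) M := ⟨fun c r m => by
    rw [smul_def, smul_def, map_smul, smul_assoc]⟩
  -- spanning
  let F : Submodule ℚ A := Submodule.span ℚ {a | ∃ r, ∃ l : List τ, a = f r * (l.map y).prod}
  have hF : ∀ a, a ∈ F := by
    have hmul : ∀ a : A, ∀ b ∈ F, a * b ∈ F := by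
      intro a
      have ha : a ∈ Algebra.adjoin ℚ (Set.range z ∪ Set.range y) := by rw [hgen]; trivial
      induction ha using Algebra.adjoin_induction with
      | mem a ha =>
        intro b hb
        induction hb using Submodule.span_induction with
        | mem b hb =>
          obtain ⟨r, l, rfl⟩ := hb
          rcases ha with ⟨i, rfl⟩ | ⟨j, rfl⟩
          · refine Submodule.subset_span ⟨MvPolynomial.X i * r, l, ?_⟩
            rw [map_mul, fX, mul_assoc]
          · refine Submodule.subset_span ⟨r, j :: l, ?_⟩
            rw [List.map_cons, List.prod_cons, ← mul_assoc, ← mul_assoc, fc]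
        | zero => rw [mul_zero]; exact F.zero_mem
        | add b c _ _ h1 h2 => rw [mul_add]; exact F.add_mem h1 h2
        | smul c b _ h => rw [mul_smul_comm]; exact F.smul_mem _ h
      | algebraMap c =>
        intro b hb
        rw [← Algebra.smul_def]
        exact F.smul_mem _ hb
      | add a b _ _ h1 h2 => intro c hc; rw [add_mul]; exact F.add_mem (h1 c hc) (h2 c hc)
      | mul a b _ _ h1 h2 => intro c hc; rw [mul_assoc]; exact h1 _ (h2 c hc)
    intro a
    have h1 : (1 : A) ∈ F := Submodule.subset_span ⟨1, [], by simp⟩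
    simpa using hmul a 1 h1
  have hdetR : ∀ m : M, m ≠ 0 → ∃ r : MvPolynomial σ ℚ, ∃ l : {l : List τ // l.Nodup},
      q ((l.1.map y).prod • r • m) ≠ 0 := by
    intro m hm
    by_contra hcon
    push Not at hcon
    obtain ⟨a, ha⟩ := hq m hm
    apply ha
    have := hF a
    clear ha
    induction this using Submodule.span_induction with
    | mem a h =>
      obtain ⟨r, l, rfl⟩ := h
      by_cases hl : l.Nodup
      · rw [fc, mul_smul]
        exact hcon r ⟨l, hl⟩
      · rw [word_dup_zero y hy l hl, mul_zero, zero_smul, map_zero]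
    | zero => rw [zero_smul, map_zero]
    | add a b _ _ h1 h2 => rw [add_smul, map_add, h1, h2, add_zero]
    | smul c a _ h => rw [smul_assoc, map_smul, h, smul_zero]
  -- the socle
  let Z : Submodule ℚ M := ⨅ i, LinearMap.ker (Module.toModuleEnd ℚ (S := A) M (z i))
  have memZ : ∀ m, m ∈ Z ↔ ∀ i, z i • m = 0 := fun m => by
    simp only [Z, Submodule.mem_iInf]; rfl
  have hact : ∀ r : MvPolynomial σ ℚ, ∃ c : ℚ, ∀ m ∈ Z, r • m = c • m := by
    intro r
    induction r using MvPolynomial.induction_on with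
    | C c => exact ⟨c, fun m _ => algebraMap_smul (MvPolynomial σ ℚ) c m⟩
    | add r s h1 h2 =>
      obtain ⟨c, hc⟩ := h1
      obtain ⟨d, hd⟩ := h2
      exact ⟨c + d, fun m hm => by rw [add_smul, add_smul, hc m hm, hd m hm]⟩
    | mul_X r i _ =>
      exact ⟨0, fun m hm => by
        rw [mul_smul, smul_def (MvPolynomial.X i), fX, (memZ m).1 hm i, smul_zero, zero_smul]⟩
  let _ : Fintype {l : List τ // l.Nodup} := fintypeNodupList
  let q' : Z →ₗ[ℚ] ({l : List τ // l.Nodup} → N) := LinearMap.pi fun l =>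
    q ∘ₗ (Module.toModuleEnd ℚ (S := A) M (l.1.map y).prod) ∘ₗ Z.subtype
  have hq' : Function.Injective q' := by
    rw [← LinearMap.ker_eq_bot, LinearMap.ker_eq_bot']
    rintro ⟨m, hm⟩ h
    by_contra hne
    obtain ⟨r, l, hr⟩ := hdetR m (fun h0 => hne (Subtype.ext h0))
    obtain ⟨c, hc⟩ := hact r
    apply hr
    rw [hc m hm, smul_comm, map_smul]
    have : q ((l.1.map y).prod • m) = 0 := congrFun h l
    rw [this, smul_zero]
  have hZf : FiniteDimensional ℚ Z := Module.Finite.of_injective q' hq'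
  have hZst : ∀ u, ∀ m ∈ Z, π u m ∈ Z := by
    intro u m hm
    rw [memZ] at hm ⊢
    intro i
    have := hcomm i (u - w i) m
    rw [sub_add_cancel, hm i, map_zero] at this
    exact this.symm
  obtain ⟨n0, hn0⟩ := finite_ortho (fun u => (π u).restrict (hZst u))
    (fun u m => Subtype.ext (hid u m)) (fun u v m h => Subtype.ext (hort u v m h))
  refine dual_growth (MvPolynomial.X : σ → MvPolynomial σ ℚ) MvPolynomial.adjoin_range_X w hw M π
    hid hort ?_ hfin n0 ?_
  · intro i u m
    rw [smul_def, smul_def, fX, hcomm]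
  · intro u hu m hm
    have hmem : π u m ∈ Z := (memZ _).2 fun i => by
      rw [← fX i]; exact hm i
    have := congrArg Subtype.val (hn0 u hu ⟨π u m, hmem⟩)
    change π u (π u m) = 0 at this
    rwa [hid] at this

lemma EvD.quasi (l : List ℤ) (T : ℕ) (hT : 0 < T) (hl : ∀ w ∈ l, 0 < w ∧ w ∣ (T : ℤ))
    {f : ℤ → ℚ} (h : EvD l f) :
    ∃ P : ZMod T → Polynomial ℚ, (∀ j, (P j).degree < (l.length : WithBot ℕ)) ∧
      ∃ N : ℤ, ∀ n, N ≤ n → f n = (P (n : ZMod T)).eval (n : ℚ) := by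
  have h' := EvD.replicate (T : ℤ) l (fun w hw => by
    obtain ⟨h0, c, hc⟩ := hl w hw
    have : 0 ≤ c := by
      by_contra hneg
      have : (0 : ℤ) < T := by exact_mod_cast hT
      nlinarith
    lift c to ℕ using this
    exact ⟨c, by rw [hc, mul_comm]⟩) h
  choose P hP N hN using EvD.poly (T : ℤ) (by exact_mod_cast hT) l.length h'
  have : NeZero T := ⟨hT.ne'⟩
  refine ⟨fun j => P (j.val : ℤ), fun j => hP _, ∑ j : ZMod T, |N (j.val : ℤ)|, fun n hn => ?_⟩
  refine hN _ n (le_trans ?_ hn) ?_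
  · refine (le_abs_self _).trans ?_
    exact Finset.single_le_sum (f := fun j : ZMod T => |N (j.val : ℤ)|) (fun j _ => abs_nonneg _)
      (Finset.mem_univ (n : ZMod T))
  · rw [ZMod.val_intCast]
    exact Int.dvd_self_sub_emod

section GSymLemmas

variable (W : ℤ × ℤ → Type) [∀ p, AddCommGroup (W p)] [∀ p, Module ℚ (W p)]

/-- The generator map as a linear map. -/
noncomputable def GSym.genL (p : ℤ × ℤ) : W p →ₗ[ℚ] GSym W :=
  (RingQuot.mkAlgHom ℚ (GSymRel W)).toLinearMap ∘ₗ TensorAlgebra.ι ℚ ∘ₗ DirectSum.lof ℚ _ W p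

lemma GSym.genL_apply (p : ℤ × ℤ) (x : W p) : GSym.genL W p x = GSym.gen W p x := rfl

lemma GSym.gen_comm (p q : ℤ × ℤ) (x : W p) (y : W q) :
    GSym.gen W p x * GSym.gen W q y
      = ((-1 : ℚ) ^ (p.2 * q.2)) • (GSym.gen W q y * GSym.gen W p x) := by
  have h := RingQuot.mkAlgHom_rel ℚ (GSymRel.comm p q x y)
  rw [map_mul, map_smul, map_mul] at h
  exact h

/-- The quotient map from the tensor algebra. -/
noncomputable def GSym.mkA : TensorAlgebra ℚ (⨁ p, W p) →ₐ[ℚ] GSym W :=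
  RingQuot.mkAlgHom ℚ (GSymRel W)

lemma GSym.mkA_surjective : Function.Surjective (GSym.mkA W) :=
  RingQuot.mkAlgHom_surjective ℚ (GSymRel W)

lemma GSym.adjoin_gen : Algebra.adjoin ℚ {a : GSym W | ∃ p x, a = GSym.gen W p x} = ⊤ := by
  have h1 : (⊤ : Subalgebra ℚ (GSym W)) = (⊤ : Subalgebra ℚ (TensorAlgebra ℚ (⨁ p, W p))).map
      (GSym.mkA W) := by
    rw [Algebra.map_top]
    exact ((AlgHom.range_eq_top _).2 (GSym.mkA_surjective W)).symm
  rw [h1, ← TensorAlgebra.adjoin_range_ι, AlgHom.map_adjoin]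
  refine le_antisymm (Algebra.adjoin_mono ?_) (Algebra.adjoin_le ?_)
  · rintro _ ⟨p, x, rfl⟩
    exact ⟨_, ⟨_, rfl⟩, rfl⟩
  · rintro _ ⟨_, ⟨v, rfl⟩, rfl⟩
    induction v using DirectSum.induction_on with
    | zero => rw [map_zero, map_zero]; exact Subalgebra.zero_mem _
    | of p x => exact Algebra.subset_adjoin ⟨p, x, rfl⟩
    | add v w hv hw => rw [map_add, map_add]; exact Subalgebra.add_mem _ hv hw

lemma GSym.gen_mem_grade (p : ℤ × ℤ) (x : W p) : GSym.gen W p x ∈ GSym.grade W p :=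
  Submodule.subset_span ⟨[⟨p, x⟩], by simp, by simp⟩

lemma GSym.even_central (p : ℤ × ℤ) (x : W p) (hp : Even p.2) (a : GSym W) :
    GSym.gen W p x * a = a * GSym.gen W p x := by
  have ha : a ∈ Algebra.adjoin ℚ {a : GSym W | ∃ p x, a = GSym.gen W p x} := by
    rw [GSym.adjoin_gen]; trivial
  induction ha using Algebra.adjoin_induction with
  | mem a h =>
    obtain ⟨q, y, rfl⟩ := h
    rw [GSym.gen_comm, (hp.mul_right q.2).neg_one_zpow, one_smul]
  | algebraMap c => exact (Algebra.commutes c _).symm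
  | add a b _ _ h1 h2 => rw [mul_add, add_mul, h1, h2]
  | mul a b _ _ h1 h2 => rw [← mul_assoc, h1, mul_assoc, h2, mul_assoc]

lemma GSym.odd_anti (p q : ℤ × ℤ) (x : W p) (y : W q) (hp : ¬ Even p.2) (hq : ¬ Even q.2) :
    GSym.gen W p x * GSym.gen W q y = - (GSym.gen W q y * GSym.gen W p x) := by
  rw [Int.not_even_iff_odd] at hp hq
  rw [GSym.gen_comm, (hp.mul hq).neg_one_zpow, neg_smul, one_smul]

end GSymLemmas

lemma slope_aux {a b n i : ℤ} (ha : 0 < a) (hab : Int.gcd a b = 1) (hn : n ≠ 0)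
    (h : (i : ℚ) / (n : ℚ) = (b : ℚ) / (a : ℚ)) : ∃ t, n = a * t ∧ i = b * t := by
  have hn' : (n : ℚ) ≠ 0 := by exact_mod_cast hn
  have ha' : (a : ℚ) ≠ 0 := by exact_mod_cast ha.ne'
  rw [div_eq_div_iff hn' ha'] at h
  have h' : i * a = b * n := by exact_mod_cast h
  have hd : a ∣ n := by
    refine Int.dvd_of_dvd_mul_right_of_gcd_one (b := b) ?_ hab
    exact ⟨i, by rw [← h', mul_comm]⟩
  obtain ⟨t, rfl⟩ := hd
  refine ⟨t, rfl, ?_⟩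
  have : a * (i - b * t) = 0 := by linear_combination h'
  rcases mul_eq_zero.1 this with h | h <;> omega

/-- existence of projections for an internal grading -/
lemma exists_proj {M : Type} [AddCommGroup M] [Module ℚ M] (Mgr : ℤ × ℤ → Submodule ℚ M)
    (hdec : DirectSum.IsInternal Mgr) :
    ∃ pr : ℤ × ℤ → M →ₗ[ℚ] M, (∀ p m, pr p m ∈ Mgr p) ∧ (∀ p, ∀ m ∈ Mgr p, pr p m = m) ∧
      (∀ p q, ∀ m ∈ Mgr q, p ≠ q → pr p m = 0) := by
  classical
  let e := LinearEquiv.ofBijective (DirectSum.coeLinearMap Mgr) hdec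
  have he : ∀ p (m : Mgr p), e.symm m = DirectSum.lof ℚ _ (fun p => Mgr p) p m := by
    intro p m
    rw [LinearEquiv.symm_apply_eq]
    exact (DirectSum.coeLinearMap_lof Mgr p m).symm
  refine ⟨fun p => (Mgr p).subtype ∘ₗ DirectSum.component ℚ _ (fun p => Mgr p) p ∘ₗ
    e.symm.toLinearMap, fun p m => Subtype.prop _, fun p m hm => ?_, fun p q m hm hpq => ?_⟩
  · show ((DirectSum.component ℚ _ (fun p => Mgr p) p (e.symm m) : Mgr p) : M) = m
    rw [he p ⟨m, hm⟩, DirectSum.component.lof_self]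
  · show ((DirectSum.component ℚ _ (fun p => Mgr p) p (e.symm m) : Mgr p) : M) = 0
    rw [he q ⟨m, hm⟩, DirectSum.component.of, dif_neg hpq.symm]
    rfl

theorem finitely_detected_growth
    (V : ℤ × ℤ → Type) [∀ p, AddCommGroup (V p)] [∀ p, Module ℚ (V p)]
    (C : ℚ)
    (hft : Bigraded.FiniteType V)
    -- `S` is the (finite) support of `V`, so that `V` is finite dimensional:
    (S : Finset (ℤ × ℤ)) (hS : ∀ p, p ∈ S ↔ Nontrivial (V p))
    (hfq : Bigraded.FirstQuadrant V)
    (hslope : Bigraded.OfSlope V C)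
    -- `M`, a bigraded `Sym(V^∨)`-module of finite type:
    (M : Type) [AddCommGroup M] [Module ℚ M] [Module (GSym (Bigraded.dual V)) M]
    [IsScalarTower ℚ (GSym (Bigraded.dual V)) M]
    (Mgr : ℤ × ℤ → Submodule ℚ M) (hdec : DirectSum.IsInternal Mgr)
    (hcompat : ∀ (p q : ℤ × ℤ) (a : GSym (Bigraded.dual V)) (m : M),
      a ∈ GSym.grade (Bigraded.dual V) p → m ∈ Mgr q → a • m ∈ Mgr (p + q))
    (hMft : ∀ p, FiniteDimensional ℚ (Mgr p))
    -- `M` is finitely detected: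
    (hdet : FinitelyDetected (GSym (Bigraded.dual V)) M)
    -- a ray of slope `C = b/a` in `M`, with offset `i₀`:
    (a b i₀ : ℤ) (ha : 0 < a) (hab : Int.gcd a b = 1) (hC : (b : ℚ) / (a : ℚ) = C) :
    -- the graded dimension of the ray is eventually a quasi-polynomial of period dividing
    -- `lcm(V⁰)` and degree at most `dim V⁰ - 1`:
    ∃ T : ℕ, 0 < T ∧
      (T : ℤ) ∣ ((S.filter fun p => Even p.2).image Prod.fst).lcm id ∧
      ∃ P : ZMod T → Polynomial ℚ,
        (∀ j, (P j).degree <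
          (((S.filter fun p => Even p.2).sum fun p => Module.finrank ℚ (V p)) : WithBot ℕ)) ∧
        ∃ N : ℤ, ∀ n : ℤ, N ≤ n →
          ((if a ∣ n ∧ 0 ≤ n then Module.finrank ℚ (Mgr (n, b * (n / a) + i₀)) else 0 : ℕ) : ℚ)
            = (P (n : ZMod T)).eval (n : ℚ) := by
  classical
  obtain ⟨pr, pr_mem, pr_self, pr_ne⟩ := exists_proj Mgr hdec
  have hfr : ∀ p : ℤ × ℤ, Module.finrank ℚ (Bigraded.dual V (-p.1, -p.2))
      = Module.finrank ℚ (V p) := by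
    intro p
    have h1 : ∀ q, q = p → Module.finrank ℚ (Module.Dual ℚ (V q)) = Module.finrank ℚ (V p) := by
      rintro _ rfl
      exact Subspace.dual_finrank_eq
    exact h1 (- -p.1, - -p.2) (by simp)
  have hfd : ∀ q, FiniteDimensional ℚ (Bigraded.dual V q) := by
    intro q
    have := hft (-q.1, -q.2)
    exact inferInstanceAs (FiniteDimensional ℚ (Module.Dual ℚ (V (-q.1, -q.2))))
  let bas : ∀ p : ℤ × ℤ, Module.Basis (Fin (Module.finrank ℚ (V p))) ℚ
      (Bigraded.dual V (-p.1, -p.2)) := fun p => Module.finBasisOfFinrankEq ℚ _ (hfr p)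
  have hSpos : ∀ p ∈ S, 0 < p.1 ∧ ∃ t, p.1 = a * t ∧ p.2 = b * t := by
    intro p hp
    have hnt := (hS p).1 hp
    obtain ⟨h0, hsl⟩ := hslope p hnt
    refine ⟨?_, slope_aux ha hab h0 (hsl.trans hC.symm)⟩
    by_contra hneg
    have := hfq p (Or.inl (by omega))
    exact not_subsingleton (V p) this
  let σ : Type := Σ p : {p // p ∈ S.filter fun p => Even p.2}, Fin (Module.finrank ℚ (V p.1))
  let τ : Type := Σ p : {p // p ∈ S.filter fun p => ¬ Even p.2}, Fin (Module.finrank ℚ (V p.1))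
  let z : σ → GSym (Bigraded.dual V) := fun s => GSym.gen _ _ (bas s.1.1 s.2)
  let y : τ → GSym (Bigraded.dual V) := fun s => GSym.gen _ _ (bas s.1.1 s.2)
  let w : σ → ℤ := fun s => s.1.1.1
  have hσS : ∀ s : σ, s.1.1 ∈ S ∧ Even s.1.1.2 := fun s => Finset.mem_filter.1 s.1.2
  have hτS : ∀ s : τ, s.1.1 ∈ S ∧ ¬ Even s.1.1.2 := fun s => Finset.mem_filter.1 s.1.2
  have hgen : Algebra.adjoin ℚ (Set.range z ∪ Set.range y) = ⊤ := by
    rw [eq_top_iff, ← GSym.adjoin_gen]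
    refine Algebra.adjoin_le ?_
    rintro _ ⟨q, v, rfl⟩
    obtain ⟨p, rfl⟩ : ∃ p : ℤ × ℤ, q = (-p.1, -p.2) := ⟨(-q.1, -q.2), by simp⟩
    show GSym.gen _ _ v ∈ Algebra.adjoin ℚ (Set.range z ∪ Set.range y)
    by_cases hp : p ∈ S
    · rw [← (bas p).sum_repr v, ← GSym.genL_apply, map_sum]
      refine Subalgebra.sum_mem _ fun k _ => ?_
      rw [map_smul, GSym.genL_apply]
      refine Subalgebra.smul_mem _ (Algebra.subset_adjoin ?_) _
      by_cases he : Even p.2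
      · exact Or.inl ⟨⟨⟨p, Finset.mem_filter.2 ⟨hp, he⟩⟩, k⟩, rfl⟩
      · exact Or.inr ⟨⟨⟨p, Finset.mem_filter.2 ⟨hp, he⟩⟩, k⟩, rfl⟩
    · have hsub : Subsingleton (V p) := not_nontrivial_iff_subsingleton.1 fun h => hp ((hS p).2 h)
      have h0 : Module.finrank ℚ (Bigraded.dual V (-p.1, -p.2)) = 0 := by
        rw [hfr]; exact Module.finrank_zero_of_subsingleton
      have : Subsingleton (Bigraded.dual V (-p.1, -p.2)) := Module.finrank_zero_iff.1 h0
      rw [Subsingleton.elim v 0, ← GSym.genL_apply, map_zero]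
      exact Subalgebra.zero_mem _
  -- how projections interact with generators
  have pr_comm : ∀ (p : ℤ × ℤ) (v : Bigraded.dual V (-p.1, -p.2)) (q : ℤ × ℤ) (m : M),
      pr q (GSym.gen _ _ v • m) = GSym.gen _ _ v • pr (q + p) m := by
    intro p v q m
    have hm : m ∈ ⨆ r, Mgr r := by
      rw [hdec.submodule_iSup_eq_top]; trivial
    induction hm using Submodule.iSup_induction' with
    | zero => simp
    | add m m' _ _ h1 h2 => rw [smul_add, map_add, map_add, smul_add, h1, h2]
    | mem r m hm =>
      have hmem := hcompat _ r _ m (GSym.gen_mem_grade (Bigraded.dual V) _ v) hm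
      by_cases hr : r = q + p
      · subst hr
        have hq : ((-p.1, -p.2) : ℤ × ℤ) + (q + p) = q := by
          ext <;> simp
        rw [hq] at hmem
        rw [pr_self _ _ hmem, pr_self _ _ hm]
      · rw [pr_ne _ _ _ hm (Ne.symm hr), smul_zero]
        refine pr_ne _ _ _ hmem ?_
        rintro rfl
        apply hr
        ext <;> simp
  let pt : ℤ → ℤ × ℤ := fun n => (n, b * (n / a) + i₀)
  let π : ℤ → M →ₗ[ℚ] M := fun n => if a ∣ n then pr (pt n) else 0
  have π_pos : ∀ n, a ∣ n → π n = pr (pt n) := fun n h => if_pos h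
  have π_neg : ∀ n, ¬ a ∣ n → π n = 0 := fun n h => if_neg h
  have hrange : ∀ n, a ∣ n → LinearMap.range (π n) = Mgr (pt n) := by
    intro n hn
    rw [π_pos n hn]
    ext m
    constructor
    · rintro ⟨m, rfl⟩; exact pr_mem _ _
    · intro hm; exact ⟨m, pr_self _ _ hm⟩
  have hrank : ∀ n, Module.finrank ℚ (LinearMap.range (π n))
      = if a ∣ n then Module.finrank ℚ (Mgr (n, b * (n / a) + i₀)) else 0 := by
    intro n
    split_ifs with hn
    · exact finrank_congr_eq (hrange n hn)
    · rw [π_neg n hn, LinearMap.range_zero]; exact finrank_bot ℚ M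
  have hEv := detected_growth z y
    (fun s x => GSym.even_central _ _ _ (by simpa using (hσS s).2) x)
    (fun s t => GSym.odd_anti _ _ _ _ _ (by simpa using (hτS s).2) (by simpa using (hτS t).2))
    hgen w (fun s => (hSpos _ (hσS s).1).1) M
    (by
      obtain ⟨N, i1, i2, h1, q, _, hq⟩ := hdet
      exact ⟨N, i1, i2, h1, q, hq⟩)
    π
    (by
      intro u m
      by_cases hu : a ∣ u
      · rw [π_pos u hu, pr_self _ _ (pr_mem _ _)]
      · rw [π_neg u hu]; rfl)
    (by
      intro u v m huv
      by_cases hu : a ∣ u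
      · by_cases hv : a ∣ v
        · rw [π_pos u hu, π_pos v hv]
          exact pr_ne _ _ _ (pr_mem _ _) fun h => huv (congrArg Prod.fst h)
        · rw [π_neg v hv, LinearMap.zero_apply, map_zero]
      · rw [π_neg u hu]; rfl)
    (by
      intro s u m
      obtain ⟨_, t, ht1, ht2⟩ := hSpos _ (hσS s).1
      have hw : w s = a * t := ht1
      by_cases hu : a ∣ u
      · rw [π_pos u hu, π_pos (u + w s) (by rw [hw]; exact dvd_add hu ⟨t, rfl⟩)]
        have hpt : pt (u + w s) = pt u + s.1.1 := by
          ext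
          · rfl
          · show b * ((u + w s) / a) + i₀ = b * (u / a) + i₀ + s.1.1.2
            rw [hw, Int.add_mul_ediv_left _ _ ha.ne', ht2]
            ring
        rw [hpt]
        exact pr_comm _ _ _ _
      · rw [π_neg u hu, π_neg (u + w s) (by
          rw [hw]
          exact fun h => hu ((Int.dvd_add_left ⟨t, rfl⟩).1 h))]
        simp)
    (by
      intro u
      by_cases hu : a ∣ u
      · rw [hrange u hu]; exact hMft _
      · rw [π_neg u hu, LinearMap.range_zero]; infer_instance)
  let L : ℤ := ((S.filter fun p => Even p.2).image Prod.fst).lcm id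
  have hL0 : L ≠ 0 := by
    intro h
    obtain ⟨n, hn, h0⟩ := Finset.lcm_eq_zero_iff.1 h
    obtain ⟨p, hp, rfl⟩ := Finset.mem_image.1 hn
    have := (hSpos p (Finset.mem_filter.1 hp).1).1
    simp at h0
    omega
  obtain ⟨P, hPdeg, N, hN⟩ := EvD.quasi _ L.natAbs (Int.natAbs_pos.2 hL0) (by
    intro v hv
    obtain ⟨s, _, rfl⟩ := List.mem_map.1 hv
    refine ⟨(hSpos _ (hσS s).1).1, ?_⟩
    rw [Int.dvd_natAbs]
    exact Finset.dvd_lcm (f := id) (Finset.mem_image_of_mem Prod.fst s.1.2)) hEv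
  have hcard : ((Finset.univ : Finset σ).toList.map w).length
      = (S.filter fun p => Even p.2).sum fun p => Module.finrank ℚ (V p) := by
    rw [List.length_map, Finset.length_toList, Finset.card_univ]
    rw [Fintype.card_sigma]
    simp only [Fintype.card_fin]
    exact Finset.sum_coe_sort (S.filter fun p => Even p.2) fun p => Module.finrank ℚ (V p)
  refine ⟨L.natAbs, Int.natAbs_pos.2 hL0, Int.natAbs_dvd.2 dvd_rfl, P, ?_, max N 0, ?_⟩
  · intro j
    have := hPdeg j
    rw [hcard] at this
    push_cast at this ⊢
    exact this
  · intro n hn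
    rw [← hN n (le_trans (le_max_left _ _) hn), hrank]
    have h0 : 0 ≤ n := le_trans (le_max_right _ _) hn
    simp [h0]
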